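/- Every Q-res refutation of Φ_n and every Q-res refutation of Ω_n has superpolynomial size: for every polynomial q, for all sufficiently large n, every Q-res refutation of Φ_n has size greater than q(n), and every Q-res refutation of Ω_n has size greater than q(n). -/

import Mathlib

/-! ## Propositional / QBF side -/

inductive Lit where
  | pos (x : ℕ)
  | neg (x : ℕ)
deriving DecidableEq

def Lit.var : Lit → ℕ
  | pos x => x
  | neg x => x

def Lit.isPos : Lit → Bool
  | pos _ => true
  | neg _ => false

def Lit.negate : Lit → Lit
  | pos x => neg x
  | neg x => pos x

def Lit.eval (v : ℕ → Bool) : Lit → Bool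
  | pos x => v x
  | neg x => !(v x)

abbrev Clause := Finset Lit

def Clause.Taut (C : Clause) : Prop := ∃ x, Lit.pos x ∈ C ∧ Lit.neg x ∈ C

/-- A prenex CNF: a list of quantifier blocks (`true` = existential,
`false` = universal), each with an ordered list of variables, and a matrix
which is a finite set of clauses. -/
structure PCNF where
  blocks : List (Bool × List ℕ)
  matrix : Finset Clause

def PCNF.allVars (Φ : PCNF) : List ℕ := Φ.blocks.flatMap (·.2)

/-- Well-formedness: quantifier blocks alternate and the blocks are
pairwise disjoint sets of variables (no repetitions). -/
def PCNF.WF (Φ : PCNF) : Prop :=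
  List.Chain' (fun a b => a.1 ≠ b.1) Φ.blocks ∧ Φ.allVars.Nodup ∧
    ∀ b ∈ Φ.blocks, b.2 ≠ []

/-- Closedness: every variable of the matrix is quantified in the prefix. -/
def PCNF.Closed (Φ : PCNF) : Prop :=
  ∀ C ∈ Φ.matrix, ∀ l ∈ C, l.var ∈ Φ.allVars

def PCNF.existB (Φ : PCNF) (x : ℕ) : Bool :=
  Φ.blocks.any fun b => b.1 && b.2.contains x

def PCNF.univB (Φ : PCNF) (x : ℕ) : Bool :=
  Φ.blocks.any fun b => !b.1 && b.2.contains x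

/-- The level of a variable: the index of its quantifier block. -/
def PCNF.lv (Φ : PCNF) (x : ℕ) : ℕ :=
  Φ.blocks.findIdx fun b => b.2.contains x

def evalClause (v : ℕ → Bool) (C : Clause) : Prop := ∃ l ∈ C, l.eval v = true

/-- Standard QBF semantics of a prenex CNF, evaluated block by block. -/
def truthAux (M : Finset Clause) : List (Bool × List ℕ) → (ℕ → Bool) → Prop
  | [], v => ∀ C ∈ M, evalClause v C
  | (q, xs) :: rest, v =>
      if q then ∃ w : ℕ → Bool, (∀ y, y ∉ xs → w y = v y) ∧ truthAux M rest w
      else ∀ w : ℕ → Bool, (∀ y, y ∉ xs → w y = v y) → truthAux M rest w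

def PCNF.IsTrue (Φ : PCNF) : Prop := truthAux Φ.matrix Φ.blocks fun _ => false

/-! ## Q-resolution and QU-resolution -/

/-- One derivation step of Q-res (`univPivot = false`) resp. QU-res
(`univPivot = true`) from the clauses derived so far. -/
inductive QStep (Φ : PCNF) (univPivot : Bool) (prev : List Clause) : Clause → Prop
  | ax (C : Clause) (hC : C ∈ Φ.matrix) (hnt : ¬ C.Taut) : QStep Φ univPivot prev C
  | res (x : ℕ) (A B : Clause) (hA : A ∈ prev) (hB : B ∈ prev)
      (hxa : Lit.pos x ∈ A) (hxb : Lit.neg x ∈ B)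
      (hpiv : Φ.existB x = true ∨ (univPivot = true ∧ Φ.univB x = true))
      (hblock : ∀ l ∈ A.erase (Lit.pos x), l.negate ∉ B.erase (Lit.neg x)) :
      QStep Φ univPivot prev ((A.erase (Lit.pos x)) ∪ (B.erase (Lit.neg x)))
  | fac (A : Clause) (hA : A ∈ prev) : QStep Φ univPivot prev A
  | univRed (A : Clause) (m : Lit) (hA : A ∈ prev) (hm : m ∈ A)
      (hu : Φ.univB m.var = true)
      (hlv : ∀ l ∈ A.erase m, Φ.existB l.var = true → Φ.lv l.var < Φ.lv m.var) :
      QStep Φ univPivot prev (A.erase m)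

def QValid (Φ : PCNF) (univPivot : Bool) (π : List Clause) : Prop :=
  ∀ i < π.length, QStep Φ univPivot (π.take i) π[i]!

def QRefutation (Φ : PCNF) (univPivot : Bool) (π : List Clause) : Prop :=
  QValid Φ univPivot π ∧ π ≠ [] ∧ π.getLast! = (∅ : Clause)

/-- Size of a (QBF) resolution derivation: total number of literal
occurrences in its clauses. -/
def qSize (π : List Clause) : ℕ := (π.map Finset.card).sum

/-! ## First-order terms, atoms, literals, clauses -/

inductive FTerm where
  | var (x : ℕ)
  | app (f : ℕ) (args : List FTerm)

noncomputable instance : DecidableEq FTerm := Classical.decEq _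

def FTerm.subst (σ : ℕ → FTerm) : FTerm → FTerm
  | .var x => σ x
  | .app f args => .app f (args.attach.map fun t => t.1.subst σ)
decreasing_by
  have := List.sizeOf_lt_of_mem t.2
  simp only [FTerm.app.sizeOf_spec]; omega

def FTerm.symSize : FTerm → ℕ
  | .var _ => 1
  | .app _ args => 1 + (args.attach.map fun t => t.1.symSize).sum
decreasing_by
  have := List.sizeOf_lt_of_mem t.2
  simp only [FTerm.app.sizeOf_spec]; omega

def FTerm.vars : FTerm → Finset ℕ
  | .var x => {x}
  | .app _ args => (args.attach.map fun t => t.1.vars).foldr (· ∪ ·) ∅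
decreasing_by
  have := List.sizeOf_lt_of_mem t.2
  simp only [FTerm.app.sizeOf_spec]; omega

/-- An atom `p(t₁,…,t_k)`: predicate symbol together with argument list. -/
structure FAtom where
  p : ℕ
  args : List FTerm

noncomputable instance : DecidableEq FAtom := Classical.decEq _

def FAtom.subst (σ : ℕ → FTerm) (a : FAtom) : FAtom := ⟨a.p, a.args.map (FTerm.subst σ)⟩
def FAtom.symSize (a : FAtom) : ℕ := 1 + (a.args.map FTerm.symSize).sum
def FAtom.vars (a : FAtom) : Finset ℕ := (a.args.map FTerm.vars).foldr (· ∪ ·) ∅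

inductive FLit where
  | pos (a : FAtom)
  | neg (a : FAtom)

noncomputable instance : DecidableEq FLit := Classical.decEq _

def FLit.atom : FLit → FAtom
  | pos a => a
  | neg a => a

def FLit.isPos : FLit → Bool
  | pos _ => true
  | neg _ => false

def FLit.subst (σ : ℕ → FTerm) : FLit → FLit
  | pos a => pos (a.subst σ)
  | neg a => neg (a.subst σ)

def FLit.symSize (l : FLit) : ℕ :=
  match l with
  | .pos a => a.symSize
  | .neg a => 1 + a.symSize

abbrev FClause := Finset FLit

noncomputable def FClause.subst (σ : ℕ → FTerm) (C : FClause) : FClause :=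
  C.image (FLit.subst σ)

noncomputable def FClause.symSize (C : FClause) : ℕ := ∑ l ∈ C, l.symSize

noncomputable def FClause.fvars (C : FClause) : Finset ℕ := C.sup fun l => l.atom.vars

/-! ## First-order resolution R1 -/

def compSub (σ μ : ℕ → FTerm) : ℕ → FTerm := fun x => (σ x).subst μ

def Unifies (σ : ℕ → FTerm) (a b : FAtom) : Prop := a.subst σ = b.subst σ

def IsMGU (σ : ℕ → FTerm) (a b : FAtom) : Prop :=
  Unifies σ a b ∧ ∀ τ, Unifies τ a b → ∃ μ, ∀ x, compSub σ μ x = τ x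

/-- `D` is a factor of `C`: `D = Cσ` for `σ` an mgu of two distinct
same-sign literals of `C`. -/
def IsFactor (C D : FClause) : Prop :=
  ∃ K L σ, K ∈ C ∧ L ∈ C ∧ K ≠ L ∧ K.isPos = L.isPos ∧
    IsMGU σ K.atom L.atom ∧ D = C.subst σ

def renameSub (ρ : ℕ → ℕ) : ℕ → FTerm := fun x => .var (ρ x)

/-- `E` is a resolvent of `C` and `D`. -/
def IsResolvent (C D E : FClause) : Prop :=
  ∃ ρ : ℕ → ℕ, Function.Injective ρ ∧
    ∃ K L σ, Disjoint C.fvars (FClause.subst (renameSub ρ) D).fvars ∧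
      K ∈ C ∧ L ∈ FClause.subst (renameSub ρ) D ∧ K.isPos = !L.isPos ∧
      IsMGU σ K.atom L.atom ∧
      E = ((C.subst σ).erase (K.subst σ)) ∪
          (((FClause.subst (renameSub ρ) D).subst σ).erase (L.subst σ))

def R1Valid (S : Set FClause) (π : List FClause) : Prop :=
  ∀ i < π.length,
    π[i]! ∈ S ∨ (∃ j < i, IsFactor π[j]! π[i]!) ∨
      (∃ j < i, ∃ k < i, IsResolvent π[j]! π[k]! π[i]!)

def R1Refutation (S : Set FClause) (π : List FClause) : Prop :=
  R1Valid S π ∧ π ≠ [] ∧ π.getLast! = (∅ : FClause)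

noncomputable def r1Size (π : List FClause) : ℕ := (π.map FClause.symSize).sum

/-- Tree-form R1 refutations: every clause occurrence is used at most once
as a premise, which is inherent in a tree-structured derivation. -/
inductive R1Tree (S : Set FClause) : FClause → Type
  | input (C : FClause) (h : C ∈ S) : R1Tree S C
  | factor {C : FClause} (t : R1Tree S C) (D : FClause) (h : IsFactor C D) : R1Tree S D
  | resolve {C D : FClause} (t₁ : R1Tree S C) (t₂ : R1Tree S D) (E : FClause)
      (h : IsResolvent C D E) : R1Tree S E

noncomputable def R1Tree.size {S : Set FClause} : {C : FClause} → R1Tree S C → ℕ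
  | C, .input _ _ => C.symSize
  | D, .factor t _ _ => t.size + D.symSize
  | E, .resolve t₁ t₂ _ _ => t₁.size + t₂.size + E.symSize

def R1Tree.clauseCount {S : Set FClause} : {C : FClause} → R1Tree S C → ℕ
  | _, .input _ _ => 1
  | _, .factor t _ _ => t.clauseCount + 1
  | _, .resolve t₁ t₂ _ _ => t₁.clauseCount + t₂.clauseCount + 1

/-! ## The Skolem and EPR translations -/

/-- The universal variables strictly preceding `a` in the prefix,
in prefix order. -/
def PCNF.univBefore (Φ : PCNF) (a : ℕ) : List ℕ :=
  ((Φ.blocks.flatMap fun b => b.2.map fun x => (b.1, x)).takeWhile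
      fun p => p.2 ≠ a).filterMap
    fun p => if p.1 = false then some p.2 else none

/-- `p` is the predicate symbol `0`; `f₀`, `f₁` are the constants `0`, `1`;
the Skolem function symbol for existential variable `a` is `a + 2`. -/
def skAtom (Φ : PCNF) (x : ℕ) : FAtom :=
  if Φ.existB x then ⟨0, [FTerm.app (x + 2) ((Φ.univBefore x).map FTerm.var)]⟩
  else ⟨0, [FTerm.var x]⟩

def skLit (Φ : PCNF) : Lit → FLit
  | .pos x => .pos (skAtom Φ x)
  | .neg x => .neg (skAtom Φ x)

noncomputable def skClause (Φ : PCNF) (C : Clause) : FClause := C.image (skLit Φ)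

def pf1Cl : FClause := {FLit.pos ⟨0, [FTerm.app 1 []]⟩}
def npf0Cl : FClause := {FLit.neg ⟨0, [FTerm.app 0 []]⟩}

/-- The clause set `Sk(Φ) ∪ {p(f₁), ¬p(f₀)}`. -/
noncomputable def skSet (Φ : PCNF) : Set FClause :=
  ↑(Φ.matrix.image (skClause Φ)) ∪ {pf1Cl, npf0Cl}

/-- EPR atom: `p(f_a(u₁,…,u_k))` with `k ≥ 1` becomes `p_a(u₁,…,u_k)`,
where the fresh predicate symbol `p_a` is `a + 1`. -/
def eprAtom (Φ : PCNF) (x : ℕ) : FAtom :=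
  if Φ.existB x then
    if Φ.univBefore x = [] then ⟨0, [FTerm.app (x + 2) []]⟩
    else ⟨x + 1, (Φ.univBefore x).map FTerm.var⟩
  else ⟨0, [FTerm.var x]⟩

def eprLit (Φ : PCNF) : Lit → FLit
  | .pos x => .pos (eprAtom Φ x)
  | .neg x => .neg (eprAtom Φ x)

noncomputable def eprClause (Φ : PCNF) (C : Clause) : FClause := C.image (eprLit Φ)

/-- The clause set `EPR(Φ) ∪ {p(f₁), ¬p(f₀)}`. -/
noncomputable def eprSet (Φ : PCNF) : Set FClause :=
  ↑(Φ.matrix.image (eprClause Φ)) ∪ {pf1Cl, npf0Cl}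

/-! ## IR-calc and its extensions -/

/-- An annotation: a (functional) finite set of assignments
`universal variable ↦ 0/1` (`false` = 0, `true` = 1). -/
abbrev Ann := Finset (ℕ × Bool)

def Ann.Functional (τ : Ann) : Prop := ∀ x b b', (x, b) ∈ τ → (x, b') ∈ τ → b = b'

/-- Restriction `[σ]` of an annotation to the universal variables of level
below the level of the literal `l`. -/
def annRestr (Φ : PCNF) (σ : Ann) (l : Lit) : Ann :=
  σ.filter fun p => Φ.lv p.1 < Φ.lv l.var

/-- Completion of `μ` by `τ`. -/
def annCompl (μ τ : Ann) : Ann :=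
  μ ∪ τ.filter fun p => p.1 ∉ μ.image Prod.fst

structure ALit where
  lit : Lit
  ann : Ann
deriving DecidableEq

abbrev AClause := Finset ALit

def ALit.symSize (al : ALit) : ℕ := 1 + 2 * al.ann.card
def AClause.symSize (A : AClause) : ℕ := ∑ al ∈ A, al.symSize
def aSize (π : List AClause) : ℕ := (π.map AClause.symSize).sum

/-- The annotation extracted from the universal literals of a clause:
`u ↦ 0` for positive and `u ↦ 1` for negative universal literals. -/
def axAnn (Φ : PCNF) (C : Clause) : Ann :=
  (C.filter fun l => Φ.univB l.var).image fun l =>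
    match l with
    | .pos u => (u, false)
    | .neg u => (u, true)

/-- The axiom clause of IR-calc obtained from a matrix clause. -/
def axClause (Φ : PCNF) (C : Clause) : AClause :=
  (C.filter fun l => Φ.existB l.var).image fun l => ⟨l, annRestr Φ (axAnn Φ C) l⟩

/-- Application of a variable substitution `σ_v` (universal ↦ existential)
to a literal. -/
def applySigv (σv : ℕ → Option ℕ) : Lit → Lit
  | .pos x => match σv x with | some e => .pos e | none => .pos x
  | .neg x => match σv x with | some e => .neg e | none => .neg x

def Clause.applySigv (σv : ℕ → Option ℕ) (C : Clause) : Clause :=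
  C.image (_root_.applySigv σv)

/-- Admissibility of `σ_v`: it maps universal variables to existential
variables of strictly smaller level. -/
def Admissible (Φ : PCNF) (σv : ℕ → Option ℕ) : Prop :=
  ∀ x e, σv x = some e → Φ.univB x = true ∧ Φ.existB e = true ∧ Φ.lv e < Φ.lv x

/-- One step of IR-calc(P, M, Δ, σ_v).  Plain IR-calc is the instance with
`Δ = ∅` and `σv = fun _ => none`; IR-calc^{σ_v} the instance with `Δ = ∅`. -/
inductive IRStep (Φ : PCNF) (Δ : Finset Clause) (σv : ℕ → Option ℕ)
    (prev : List AClause) : AClause → Prop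
  | ax (C : Clause) (hC : C ∈ Φ.matrix) (hnt : ¬ C.Taut)
      (hnt' : ¬ (C.applySigv σv).Taut) :
      IRStep Φ Δ σv prev (axClause Φ (C.applySigv σv))
  | axExt (C : Clause) (hC : C ∈ Δ) (hnt : ¬ C.Taut) :
      IRStep Φ Δ σv prev (C.image fun l => ⟨l, ∅⟩)
  | res (x : ℕ) (τ : Ann) (A B : AClause) (hA : A ∈ prev) (hB : B ∈ prev)
      (hxa : (⟨Lit.pos x, τ⟩ : ALit) ∈ A) (hxb : (⟨Lit.neg x, τ⟩ : ALit) ∈ B) :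
      IRStep Φ Δ σv prev ((A.erase ⟨Lit.pos x, τ⟩) ∪ (B.erase ⟨Lit.neg x, τ⟩))
  | fac (A : AClause) (hA : A ∈ prev) : IRStep Φ Δ σv prev A
  | inst (A : AClause) (τ : Ann) (hA : A ∈ prev) (hfun : τ.Functional)
      (hdom : ∀ p ∈ τ, Φ.univB p.1 = true) :
      IRStep Φ Δ σv prev
        (A.image fun al => ⟨al.lit, annRestr Φ (annCompl al.ann τ) al.lit⟩)

def IRValid (Φ : PCNF) (Δ : Finset Clause) (σv : ℕ → Option ℕ)
    (π : List AClause) : Prop :=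
  ∀ i < π.length, IRStep Φ Δ σv (π.take i) π[i]!

def IRRefutation (Φ : PCNF) (Δ : Finset Clause) (σv : ℕ → Option ℕ)
    (π : List AClause) : Prop :=
  IRValid Φ Δ σv π ∧ π ≠ [] ∧ π.getLast! = (∅ : AClause)

def noSub : ℕ → Option ℕ := fun _ => none

/-- Tree-form IR-calc(P, M, Δ, σ_v) derivations. -/
inductive IRTree (Φ : PCNF) (Δ : Finset Clause) (σv : ℕ → Option ℕ) : AClause → Type
  | ax (C : Clause) (hC : C ∈ Φ.matrix) (hnt : ¬ C.Taut)
      (hnt' : ¬ (C.applySigv σv).Taut) : IRTree Φ Δ σv (axClause Φ (C.applySigv σv))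
  | axExt (C : Clause) (hC : C ∈ Δ) (hnt : ¬ C.Taut) :
      IRTree Φ Δ σv (C.image fun l => ⟨l, ∅⟩)
  | res {A B : AClause} (t₁ : IRTree Φ Δ σv A) (t₂ : IRTree Φ Δ σv B)
      (x : ℕ) (τ : Ann)
      (hxa : (⟨Lit.pos x, τ⟩ : ALit) ∈ A) (hxb : (⟨Lit.neg x, τ⟩ : ALit) ∈ B) :
      IRTree Φ Δ σv ((A.erase ⟨Lit.pos x, τ⟩) ∪ (B.erase ⟨Lit.neg x, τ⟩))
  | inst {A : AClause} (t : IRTree Φ Δ σv A) (τ : Ann) (hfun : τ.Functional)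
      (hdom : ∀ p ∈ τ, Φ.univB p.1 = true) :
      IRTree Φ Δ σv (A.image fun al => ⟨al.lit, annRestr Φ (annCompl al.ann τ) al.lit⟩)

def IRTree.size {Φ : PCNF} {Δ : Finset Clause} {σv : ℕ → Option ℕ} :
    {A : AClause} → IRTree Φ Δ σv A → ℕ
  | _, .ax C _ _ _ => AClause.symSize (axClause Φ (C.applySigv σv))
  | _, .axExt C _ _ => AClause.symSize (C.image fun l => (⟨l, ∅⟩ : ALit))
  | _, .res (A := A) (B := B) t₁ t₂ x τ _ _ =>
      t₁.size + t₂.size +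
        AClause.symSize ((A.erase ⟨Lit.pos x, τ⟩) ∪ (B.erase ⟨Lit.neg x, τ⟩))
  | _, .inst (A := A) t τ _ _ =>
      t.size + AClause.symSize (A.image fun al =>
        (⟨al.lit, annRestr Φ (annCompl al.ann τ) al.lit⟩ : ALit))

/-! ## The formula families Φ_n and Ω_n (pigeonhole based) -/

def xv (i j : ℕ) : ℕ := Nat.pair 0 (Nat.pair i (Nat.pair j 0))
def yv (i j : ℕ) : ℕ := Nat.pair 1 (Nat.pair i (Nat.pair j 0))
def zv (i₁ i₂ j : ℕ) : ℕ := Nat.pair 2 (Nat.pair i₁ (Nat.pair i₂ j))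

def Xlist (n : ℕ) : List ℕ :=
  (List.range (n+1)).flatMap fun i => (List.range n).map fun j => xv (i+1) (j+1)
def Ylist (n : ℕ) : List ℕ :=
  (List.range (n+1)).flatMap fun i => (List.range n).map fun j => yv (i+1) (j+1)
def Zlist (n : ℕ) : List ℕ :=
  ((List.range (n+1)).map fun i => zv (i+1) 0 0) ++
  ((List.range n).flatMap fun j => (List.range (n+1)).flatMap fun i₁ =>
    (List.range (n+1)).filterMap fun i₂ =>
      if i₁ < i₂ then some (zv (i₁+1) (i₂+1) (j+1)) else none)

/-- The clauses of PHP_n(X_n). -/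
def PHPcls (n : ℕ) : Finset Clause :=
  ((List.range (n+1)).map fun i =>
      (((List.range n).map fun j => Lit.pos (xv (i+1) (j+1))).toFinset : Clause)).toFinset ∪
  ((List.range n).flatMap fun j => (List.range (n+1)).flatMap fun i₁ =>
    (List.range (n+1)).filterMap fun i₂ =>
      if i₁ < i₂ then
        some ({Lit.neg (xv (i₁+1) (j+1)), Lit.neg (xv (i₂+1) (j+1))} : Clause)
      else none).toFinset

/-- The clauses of TPHP′_n(Y_n, Z_n). -/
def TPHPcls (n : ℕ) : Finset Clause :=
  {(((Zlist n).map Lit.neg).toFinset : Clause)} ∪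
  ((List.range (n+1)).flatMap fun i => (List.range n).map fun j =>
      ({Lit.pos (zv (i+1) 0 0), Lit.neg (yv (i+1) (j+1))} : Clause)).toFinset ∪
  ((List.range n).flatMap fun j => (List.range (n+1)).flatMap fun i₁ =>
    (List.range (n+1)).flatMap fun i₂ =>
      if i₁ < i₂ then
        [({Lit.pos (zv (i₁+1) (i₂+1) (j+1)), Lit.pos (yv (i₁+1) (j+1))} : Clause),
         ({Lit.pos (zv (i₁+1) (i₂+1) (j+1)), Lit.pos (yv (i₂+1) (j+1))} : Clause)]
      else []).toFinset

def phiMatrix (n : ℕ) : Finset Clause := TPHPcls n ∪ PHPcls n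

/-- Φ_n = ∃X_n ∀Y_n ∃Z_n (TPHP′_n ∧ PHP_n). -/
def PhiF (n : ℕ) : PCNF :=
  ⟨[(true, Xlist n), (false, Ylist n), (true, Zlist n)], phiMatrix n⟩

/-- Ω_n = ∀Y_n ∃Z_n ∃X_n (TPHP′_n ∧ PHP_n) (Z_n and X_n form one block). -/
def OmegaF (n : ℕ) : PCNF :=
  ⟨[(false, Ylist n), (true, Zlist n ++ Xlist n)], phiMatrix n⟩

/-! ## The formula family Ψ_t of Kleine Büning, Karpinski and Flögel -/

def dv (j : ℕ) : ℕ := 5*j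
def ev (j : ℕ) : ℕ := 5*j+1
def xvv (j : ℕ) : ℕ := 5*j+2
def fv (j : ℕ) : ℕ := 5*j+3
def qv (j : ℕ) : ℕ := 5*j+4

/-- The prefix P_t; if `withQ` is set, the fresh extension variable `q_i`
is placed in the same existential block as `d_i` and `e_i`. -/
def psiPrefix (t : ℕ) (withQ : Bool) : List (Bool × List ℕ) :=
  ((true, [dv 0, dv 1, ev 1] ++ if withQ then [qv 1] else []) ::
    (List.range (t-1)).flatMap fun j =>
      [(false, [xvv (j+1)]),
       (true, [dv (j+2), ev (j+2)] ++ if withQ then [qv (j+2)] else [])]) ++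
  [(false, [xvv t]), (true, (List.range t).map fun i => fv (i+1))]

def fNegs (t : ℕ) : List Lit := (List.range t).map fun i => Lit.neg (fv (i+1))

def psiMatrix (t : ℕ) : Finset Clause :=
  ({({Lit.neg (dv 0)} : Clause),
    ({Lit.pos (dv 0), Lit.neg (dv 1), Lit.neg (ev 1)} : Clause),
    (((Lit.pos (dv t) :: Lit.neg (xvv t) :: fNegs t).toFinset : Clause)),
    (((Lit.pos (ev t) :: Lit.pos (xvv t) :: fNegs t).toFinset : Clause))} : Finset Clause) ∪
  ((List.range (t-1)).flatMap fun j =>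
     [({Lit.pos (dv (j+1)), Lit.neg (xvv (j+1)), Lit.neg (dv (j+2)), Lit.neg (ev (j+2))} : Clause),
      ({Lit.pos (ev (j+1)), Lit.pos (xvv (j+1)), Lit.neg (dv (j+2)), Lit.neg (ev (j+2))} : Clause)]).toFinset ∪
  ((List.range t).flatMap fun j =>
     [({Lit.neg (xvv (j+1)), Lit.pos (fv (j+1))} : Clause),
      ({Lit.pos (xvv (j+1)), Lit.pos (fv (j+1))} : Clause)]).toFinset

def PsiF (t : ℕ) : PCNF := ⟨psiPrefix t false, psiMatrix t⟩

/-- Ψ_t with the extension variables q_i added to the prefix. -/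
def PsiFq (t : ℕ) : PCNF := ⟨psiPrefix t true, psiMatrix t⟩

/-- The extension clauses Δ: clausal form of q_i ↔ (¬d_i ∧ e_i), 1 ≤ i ≤ t. -/
def DeltaT (t : ℕ) : Finset Clause :=
  ((List.range t).flatMap fun i =>
    [({Lit.pos (qv (i+1)), Lit.pos (dv (i+1)), Lit.neg (ev (i+1))} : Clause),
     ({Lit.neg (qv (i+1)), Lit.neg (dv (i+1))} : Clause),
     ({Lit.neg (qv (i+1)), Lit.pos (ev (i+1))} : Clause)]).toFinset

/-- σ_{v,t} = { x_i ↦ q_i : 1 ≤ i ≤ t }. -/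
def sigmaQv (t : ℕ) : ℕ → Option ℕ := fun v =>
  if v % 5 = 2 ∧ 1 ≤ v / 5 ∧ v / 5 ≤ t then some (5 * (v / 5) + 4) else none

/-- σ_{v,t} = { x_i ↦ e_i : 1 ≤ i ≤ t }. -/
def sigmaEv (t : ℕ) : ℕ → Option ℕ := fun v =>
  if v % 5 = 2 ∧ 1 ≤ v / 5 ∧ v / 5 ≤ t then some (5 * (v / 5) + 1) else none

namespace Haken

abbrev Crit (n : ℕ) := Fin (n+1) ≃ Option (Fin n)
abbrev Edge (n : ℕ) := Fin (n+1) × Fin n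

def Hits {n : ℕ} (M : Finset (Edge n)) (σ : Crit n) : Prop := ∃ e ∈ M, σ e.1 = some e.2

open Classical in
noncomputable def miss {n : ℕ} (σ0 : Crit n) (R : Finset (Fin (n+1))) (M : Finset (Edge n)) :
    Finset (Fin (n+1)) :=
  Finset.univ.filter fun i => ∃ σ : Crit n, (∀ p ∈ R, σ p = σ0 p) ∧ σ i = none ∧ ¬ Hits M σ

open Classical in
noncomputable def avail {n : ℕ} (σ0 : Crit n) (R : Finset (Fin (n+1))) : Finset (Edge n) :=
  Finset.univ.filter fun e => e.1 ∉ R ∧ σ0.symm (some e.2) ∉ R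

def Unhit {n : ℕ} (σ0 : Crit n) (R : Finset (Fin (n+1))) (M : Finset (Edge n)) : Prop :=
  ∀ e ∈ M, e.1 ∈ R → σ0 e.1 ≠ some e.2

def Big {n : ℕ} (σ0 : Crit n) (R : Finset (Fin (n+1))) (M : Finset (Edge n)) : Prop :=
  n * (n+1) ≤ 20 * (M ∩ avail σ0 R).card

theorem miss_sub {n : ℕ} (σ0 : Crit n) (R : Finset (Fin (n+1))) (hR : ∀ p ∈ R, σ0 p ≠ none)
    (M : Finset (Edge n)) {i : Fin (n+1)} (hi : i ∈ miss σ0 R M) : i ∉ R := by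
  classical
  simp only [miss, Finset.mem_filter, Finset.mem_univ, true_and] at hi
  obtain ⟨σ, h1, h2, _⟩ := hi
  intro h
  exact hR i h (by rw [← h1 i h, h2])

theorem miss_unhit {n : ℕ} (σ0 : Crit n) (R : Finset (Fin (n+1)))
    (M : Finset (Edge n)) {i : Fin (n+1)} (hi : i ∈ miss σ0 R M) : Unhit σ0 R M := by
  classical
  simp only [miss, Finset.mem_filter, Finset.mem_univ, true_and] at hi
  obtain ⟨σ, h1, _, h3⟩ := hi
  intro e he hR h
  exact h3 ⟨e, he, by rw [h1 _ hR, h]⟩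

theorem swap_count {n : ℕ} (σ0 : Crit n) (R : Finset (Fin (n+1))) (hR : ∀ p ∈ R, σ0 p ≠ none)
    (M : Finset (Edge n)) :
    (miss σ0 R M).card * ((n + 1 - R.card) - (miss σ0 R M).card) ≤ (M ∩ avail σ0 R).card := by
  classical
  have hsub : miss σ0 R M ⊆ Rᶜ := fun i hi => by
    simpa using miss_sub σ0 R hR M hi
  have hc : (Rᶜ \ miss σ0 R M).card = (n + 1 - R.card) - (miss σ0 R M).card := by
    rw [Finset.card_sdiff_of_subset hsub, Finset.card_compl, Fintype.card_fin]
  rw [← hc, ← Finset.card_product]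
  have hex : ∀ i, ∃ σ : Crit n, i ∈ miss σ0 R M →
      (∀ p ∈ R, σ p = σ0 p) ∧ σ i = none ∧ ¬ Hits M σ := by
    intro i
    by_cases hi : i ∈ miss σ0 R M
    · have hi' := hi
      simp only [miss, Finset.mem_filter, Finset.mem_univ, true_and] at hi'
      obtain ⟨σ, h⟩ := hi'
      exact ⟨σ, fun _ => h⟩
    · exact ⟨σ0, fun h => absurd h hi⟩
  choose α hα using hex
  apply Finset.card_le_card_of_forall_subsingleton
    (fun (a : Fin (n+1) × Fin (n+1)) (e : Edge n) => e.1 = a.1 ∧ α a.1 a.2 = some e.2)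
  · rintro ⟨i, i'⟩ ha
    simp only [Finset.mem_product, Finset.mem_sdiff, Finset.mem_compl] at ha
    obtain ⟨hi, hi'R, hi'⟩ := ha
    obtain ⟨h1, h2, h3⟩ := hα i hi
    have hiR := miss_sub σ0 R hR M hi
    have hH : Hits M ((Equiv.swap i i').trans (α i)) := by
      by_contra hcon
      apply hi'
      simp only [miss, Finset.mem_filter, Finset.mem_univ, true_and]
      refine ⟨_, ?_, ?_, hcon⟩
      · intro p hp
        have hpi : p ≠ i := fun h => hiR (h ▸ hp)
        have hpi' : p ≠ i' := fun h => hi'R (h ▸ hp)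
        simp [Equiv.swap_apply_of_ne_of_ne hpi hpi', h1 p hp]
      · simp [h2]
    obtain ⟨e, he, hs⟩ := hH
    have he1 : e.1 = i := by
      by_contra hne
      by_cases hne' : e.1 = i'
      · simp [hne', h2] at hs
      · simp only [Equiv.trans_apply, Equiv.swap_apply_of_ne_of_ne hne hne'] at hs
        exact h3 ⟨e, he, hs⟩
    simp only [Equiv.trans_apply, he1, Equiv.swap_apply_left] at hs
    refine ⟨e, ?_, he1, hs⟩
    simp only [Finset.mem_inter, he, avail, Finset.mem_filter, Finset.mem_univ, true_and]
    refine ⟨he1 ▸ hiR, ?_⟩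
    intro hp
    have h4 : α i (σ0.symm (some e.2)) = α i i' := (h1 _ hp).trans (by simp [hs])
    have h5 := (α i).injective h4
    rw [h5] at hp
    exact hi'R hp
  · rintro e he ⟨i, i'⟩ ⟨_, h1, h2⟩ ⟨k, k'⟩ ⟨_, h3, h4⟩
    simp only at h1 h2 h3 h4
    subst h1
    subst h3
    have := (α e.1).injective (h2.trans h4.symm)
    simp [this]

open Classical in
theorem greedy {n : ℕ} (hn : 1 ≤ n) {ι : Type} (F : Finset ι) (M : ι → Finset (Edge n)) (k : ℕ) :
    ∃ (σ0 : Crit n) (R : Finset (Fin (n+1))), R.card ≤ k ∧ (∀ p ∈ R, σ0 p ≠ none) ∧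
      (F.filter fun c => Unhit σ0 R (M c) ∧ Big σ0 R (M c)).card * 20 ^ k ≤ F.card * 19 ^ k := by
  induction k with
  | zero =>
    refine ⟨finSuccEquiv n, ∅, by simp, by simp, ?_⟩
    simpa using Finset.card_filter_le _ _
  | succ k ih =>
    obtain ⟨σ0, R, hk, hR, hF⟩ := ih
    set F' := F.filter fun c => Unhit σ0 R (M c) ∧ Big σ0 R (M c) with hF'
    rcases F'.eq_empty_or_nonempty with h0 | ⟨c0, hc0⟩
    · refine ⟨σ0, R, by omega, hR, ?_⟩
      rw [← hF', h0]; simp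
    have hav : (avail σ0 R).Nonempty := by
      have := (Finset.mem_filter.1 hc0).2.2
      unfold Big at this
      have h2 : 0 < (M c0 ∩ avail σ0 R).card := by
        have : 0 < n * (n+1) := by positivity
        omega
      obtain ⟨e, he⟩ := Finset.card_pos.1 h2
      exact ⟨e, (Finset.mem_inter.1 he).2⟩
    have hsum : ∑ e ∈ avail σ0 R, F'.card ≤
        ∑ e ∈ avail σ0 R, 20 * (F'.filter fun c => e ∈ M c).card := by
      have hdc : ∑ e ∈ avail σ0 R, (F'.filter fun c => e ∈ M c).card =
          ∑ c ∈ F', (M c ∩ avail σ0 R).card := by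
        have h1 := Finset.sum_card_bipartiteAbove_eq_sum_card_bipartiteBelow
          (s := avail σ0 R) (t := F') (fun e c => e ∈ M c)
        simp only [Finset.bipartiteAbove, Finset.bipartiteBelow] at h1
        rw [h1]
        refine Finset.sum_congr rfl fun c _ => ?_
        congr 1
        ext e
        simp [and_comm]
      rw [← Finset.mul_sum, hdc, Finset.mul_sum, Finset.sum_const, smul_eq_mul]
      have h1 : (avail σ0 R).card ≤ n * (n+1) := by
        refine (Finset.card_le_univ _).trans ?_
        simp [mul_comm]
      calc (avail σ0 R).card * F'.card ≤ n * (n+1) * F'.card := Nat.mul_le_mul_right _ h1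
        _ = ∑ c ∈ F', n * (n+1) := by simp [mul_comm]
        _ ≤ _ := Finset.sum_le_sum fun c hc => (Finset.mem_filter.1 hc).2.2
    obtain ⟨e, he, hcnt⟩ := Finset.exists_le_of_sum_le hav hsum
    simp only [avail, Finset.mem_filter, Finset.mem_univ, true_and] at he
    obtain ⟨he1, he2⟩ := he
    set p := σ0.symm (some e.2) with hp
    have hσp : σ0 p = some e.2 := by simp [hp]
    have hag : ∀ r ∈ R, ((Equiv.swap e.1 p).trans σ0) r = σ0 r := by
      intro r hr
      have h1 : r ≠ e.1 := fun h => he1 (h ▸ hr)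
      have h2 : r ≠ p := fun h => he2 (h ▸ hr)
      simp [Equiv.swap_apply_of_ne_of_ne h1 h2]
    have hse : ((Equiv.swap e.1 p).trans σ0) e.1 = some e.2 := by simp [hσp]
    refine ⟨(Equiv.swap e.1 p).trans σ0, insert e.1 R, ?_, ?_, ?_⟩
    · rw [Finset.card_insert_of_notMem he1]; omega
    · intro r hr
      rcases Finset.mem_insert.1 hr with rfl | hr
      · rw [hse]; simp
      · rw [hag r hr]; exact hR r hr
    · have hav' : avail ((Equiv.swap e.1 p).trans σ0) (insert e.1 R) ⊆ avail σ0 R := by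
        intro f hf
        simp only [avail, Finset.mem_filter, Finset.mem_univ, true_and] at hf ⊢
        refine ⟨fun h => hf.1 (Finset.mem_insert_of_mem h), fun h => hf.2 ?_⟩
        have : ((Equiv.swap e.1 p).trans σ0).symm (some f.2) = σ0.symm (some f.2) := by
          rw [Equiv.symm_apply_eq, hag _ h]; simp
        rw [this]
        exact Finset.mem_insert_of_mem h
      have hsub : (F.filter fun c => Unhit ((Equiv.swap e.1 p).trans σ0) (insert e.1 R) (M c) ∧
          Big ((Equiv.swap e.1 p).trans σ0) (insert e.1 R) (M c)) ⊆
          F'.filter fun c => ¬ e ∈ M c := by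
        intro c hc
        rw [Finset.mem_filter] at hc
        obtain ⟨hcF, hu, hb⟩ := hc
        rw [Finset.mem_filter, hF', Finset.mem_filter]
        refine ⟨⟨hcF, ?_, ?_⟩, ?_⟩
        · intro f hf hfR
          rw [← hag _ hfR]
          exact hu f hf (Finset.mem_insert_of_mem hfR)
        · exact le_trans hb (Nat.mul_le_mul_left _
            (Finset.card_le_card (Finset.inter_subset_inter_left hav')))
        · intro hem
          exact hu e hem (Finset.mem_insert_self _ _) hse
      have h1 := Finset.card_le_card hsub
      have h2 := Finset.card_filter_add_card_filter_not (s := F') (fun c => e ∈ M c)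
      set a := (F.filter fun c => Unhit ((Equiv.swap e.1 p).trans σ0) (insert e.1 R) (M c) ∧
          Big ((Equiv.swap e.1 p).trans σ0) (insert e.1 R) (M c)).card
      have h3 : a * 20 ≤ F'.card * 19 := by omega
      calc a * 20 ^ (k+1) = (a * 20) * 20 ^ k := by ring
        _ ≤ (F'.card * 19) * 20 ^ k := Nat.mul_le_mul_right _ h3
        _ = (F'.card * 20 ^ k) * 19 := by ring
        _ ≤ (F.card * 19 ^ k) * 19 := Nat.mul_le_mul_right _ hF
        _ = _ := by ring

end Haken
namespace Haken

theorem mem_Xlist {n v : ℕ} : v ∈ Xlist n ↔ ∃ i < n+1, ∃ j < n, xv (i+1) (j+1) = v := by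
  simp [Xlist]

theorem mem_Ylist {n v : ℕ} : v ∈ Ylist n ↔ ∃ i < n+1, ∃ j < n, yv (i+1) (j+1) = v := by
  simp [Ylist]

theorem mem_Zlist {n v : ℕ} : v ∈ Zlist n ↔ (∃ i < n+1, zv (i+1) 0 0 = v) ∨
    ∃ j < n, ∃ i₁ < n+1, ∃ i₂ < n+1, i₁ < i₂ ∧ zv (i₁+1) (i₂+1) (j+1) = v := by
  simp [Zlist]

theorem XY_disj {n v : ℕ} (h : v ∈ Xlist n) (h' : v ∈ Ylist n) : False := by
  rw [mem_Xlist] at h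
  rw [mem_Ylist] at h'
  obtain ⟨i, _, j, _, rfl⟩ := h
  obtain ⟨i', _, j', _, h⟩ := h'
  simp [xv, yv, Nat.pair_eq_pair] at h

theorem XZ_disj {n v : ℕ} (h : v ∈ Xlist n) (h' : v ∈ Zlist n) : False := by
  rw [mem_Xlist] at h
  rw [mem_Zlist] at h'
  obtain ⟨i, _, j, _, rfl⟩ := h
  rcases h' with ⟨i', _, h⟩ | ⟨_, _, _, _, _, _, _, h⟩ <;>
  simp [xv, zv, Nat.pair_eq_pair] at h

theorem YZ_disj {n v : ℕ} (h : v ∈ Ylist n) (h' : v ∈ Zlist n) : False := by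
  rw [mem_Ylist] at h
  rw [mem_Zlist] at h'
  obtain ⟨i, _, j, _, rfl⟩ := h
  rcases h' with ⟨i', _, h⟩ | ⟨_, _, _, _, _, _, _, h⟩ <;>
  simp [yv, zv, Nat.pair_eq_pair] at h

/-- All Z-variables true would make Y a violation of the pigeonhole principle. -/
theorem tphp_sat (n : ℕ) (u : ℕ → Bool) :
    ∃ v : ℕ → Bool, (∀ y ∈ Ylist n, v y = u y) ∧ ∀ C ∈ TPHPcls n, evalClause v C := by
  classical
  let g : ℕ → ℕ → ℕ → Bool := fun a b c =>
    if b = 0 then decide (∃ j < n, u (yv a (j+1)) = true)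
    else !(u (yv a c) && u (yv b c))
  let v : ℕ → Bool := fun x =>
    if x.unpair.1 = 2 then
      g x.unpair.2.unpair.1 x.unpair.2.unpair.2.unpair.1 x.unpair.2.unpair.2.unpair.2
    else u x
  have hz : ∀ a b c, v (zv a b c) = g a b c := by
    intro a b c; simp [v, zv]
  have hy : ∀ a b, v (yv a b) = u (yv a b) := by
    intro a b; simp [v, yv]
  refine ⟨v, ?_, ?_⟩
  · intro y hyl
    rw [mem_Ylist] at hyl
    obtain ⟨i, _, j, _, rfl⟩ := hyl
    exact hy _ _
  · intro C hC
    simp only [TPHPcls, Finset.mem_union, Finset.mem_singleton, List.mem_toFinset,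
      List.mem_flatMap, List.mem_map, List.mem_range] at hC
    rcases hC with (rfl | ⟨i, hi, j, hj, rfl⟩) | ⟨j, hj, i₁, h1, i₂, h2, hC⟩
    · by_contra hcon
      have hall : ∀ z ∈ Zlist n, v z = true := by
        intro z hzl
        by_contra hzf
        apply hcon
        refine ⟨Lit.neg z, ?_, ?_⟩
        · simp [hzl]
        · simpa [Lit.eval] using hzf
      have h1 : ∀ i : Fin (n+1), ∃ j : Fin n, u (yv (i+1) (j+1)) = true := by
        intro i
        have := hall (zv (i+1) 0 0) (mem_Zlist.2 (Or.inl ⟨i, i.2, rfl⟩))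
        rw [hz] at this
        simp only [g, if_true, decide_eq_true_eq] at this
        obtain ⟨j, hj, h⟩ := this
        exact ⟨⟨j, hj⟩, h⟩
      choose f hf using h1
      obtain ⟨a, b, hab, hfab⟩ := Fintype.exists_ne_map_eq_of_card_lt f (by simp)
      have key : ∀ a b : Fin (n+1), a < b → f a = f b → False := by
        intro a b hab hfab
        have := hall (zv (a+1) (b+1) (f a+1)) (mem_Zlist.2 (Or.inr
          ⟨f a, (f a).2, a, a.2, b, b.2, hab, rfl⟩))
        rw [hz] at this
        have ha := hf a
        have hb := hf b
        rw [← hfab] at hb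
        simp [g, ha, hb] at this
      rcases lt_or_gt_of_ne hab with h | h
      · exact key a b h hfab
      · exact key b a h hfab.symm
    · by_cases h : u (yv (i+1) (j+1)) = true
      · refine ⟨Lit.pos (zv (i+1) 0 0), by simp, ?_⟩
        simp only [Lit.eval, hz, g, if_true, decide_eq_true_eq]
        exact ⟨j, hj, h⟩
      · refine ⟨Lit.neg (yv (i+1) (j+1)), by simp, ?_⟩
        simpa [Lit.eval, hy] using h
    · split_ifs at hC with h12
      · simp only [List.mem_cons, List.not_mem_nil, or_false] at hC
        rcases hC with rfl | rfl
        · by_cases h : u (yv (i₁+1) (j+1)) = true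
          · exact ⟨Lit.pos (yv (i₁+1) (j+1)), by simp, by simpa [Lit.eval, hy] using h⟩
          · exact ⟨Lit.pos (zv (i₁+1) (i₂+1) (j+1)), by simp, by
              simp [Lit.eval, hz, g, h]⟩
        · by_cases h : u (yv (i₂+1) (j+1)) = true
          · exact ⟨Lit.pos (yv (i₂+1) (j+1)), by simp, by simpa [Lit.eval, hy] using h⟩
          · exact ⟨Lit.pos (zv (i₁+1) (i₂+1) (j+1)), by simp, by
              simp [Lit.eval, hz, g, h]⟩
      · simp at hC

theorem tphp_vars {n : ℕ} {C : Clause} (hC : C ∈ TPHPcls n) :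
    ∀ l ∈ C, l.var ∈ Ylist n ∨ l.var ∈ Zlist n := by
  simp only [TPHPcls, Finset.mem_union, Finset.mem_singleton, List.mem_toFinset,
    List.mem_flatMap, List.mem_map, List.mem_range] at hC
  intro l hl
  rcases hC with (rfl | ⟨i, hi, j, hj, rfl⟩) | ⟨j, hj, i₁, h1, i₂, h2, hC⟩
  · simp only [List.mem_toFinset, List.mem_map] at hl
    obtain ⟨z, hz, rfl⟩ := hl
    exact Or.inr hz
  · simp only [Finset.mem_insert, Finset.mem_singleton] at hl
    rcases hl with rfl | rfl
    · exact Or.inr (mem_Zlist.2 (Or.inl ⟨i, hi, rfl⟩))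
    · exact Or.inl (mem_Ylist.2 ⟨i, hi, j, hj, rfl⟩)
  · split_ifs at hC with h12
    · simp only [List.mem_cons, List.not_mem_nil, or_false] at hC
      rcases hC with rfl | rfl <;> simp only [Finset.mem_insert, Finset.mem_singleton] at hl <;>
      rcases hl with rfl | rfl
      · exact Or.inr (mem_Zlist.2 (Or.inr ⟨j, hj, i₁, h1, i₂, h2, h12, rfl⟩))
      · exact Or.inl (mem_Ylist.2 ⟨i₁, h1, j, hj, rfl⟩)
      · exact Or.inr (mem_Zlist.2 (Or.inr ⟨j, hj, i₁, h1, i₂, h2, h12, rfl⟩))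
      · exact Or.inl (mem_Ylist.2 ⟨i₂, h2, j, hj, rfl⟩)
    · simp at hC

/-- Clauses over the X-variables. -/
def XC (n : ℕ) (C : Clause) : Prop := ∀ l ∈ C, l.var ∈ Xlist n

/-- Non-tautological consequences of TPHP over Y and Z. -/
def YZC (n : ℕ) (C : Clause) : Prop :=
  (∀ l ∈ C, l.var ∈ Ylist n ∨ l.var ∈ Zlist n) ∧ ¬ C.Taut ∧
    ∀ v : ℕ → Bool, (∀ D ∈ TPHPcls n, evalClause v D) → evalClause v C

theorem php_vars {n : ℕ} {C : Clause} (hC : C ∈ PHPcls n) : XC n C := by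
  simp only [PHPcls, Finset.mem_union, List.mem_toFinset,
    List.mem_flatMap, List.mem_filterMap, List.mem_map, List.mem_range] at hC
  intro l hl
  rcases hC with ⟨i, hi, rfl⟩ | ⟨j, hj, i₁, h1, i₂, h2, hC⟩
  · simp only [List.mem_toFinset, List.mem_map, List.mem_range] at hl
    obtain ⟨j, hj, rfl⟩ := hl
    exact mem_Xlist.2 ⟨i, hi, j, hj, rfl⟩
  · split_ifs at hC with h12
    simp only [Option.some.injEq] at hC
    subst hC
    simp only [Finset.mem_insert, Finset.mem_singleton] at hl
    rcases hl with rfl | rfl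
    · exact mem_Xlist.2 ⟨i₁, h1, j, hj, rfl⟩
    · exact mem_Xlist.2 ⟨i₂, h2, j, hj, rfl⟩

/-- What we need about the prefix. -/
structure Pre (n : ℕ) (Φ : PCNF) : Prop where
  mat : Φ.matrix = phiMatrix n
  univ : ∀ v, Φ.univB v = true → v ∈ Ylist n
  ex : ∀ z ∈ Zlist n, Φ.existB z = true
  lv : ∀ z ∈ Zlist n, ∀ y ∈ Ylist n, ¬ Φ.lv z < Φ.lv y

theorem pre_phi (n : ℕ) : Pre n (PhiF n) where
  mat := rfl
  univ := by intro v hv; simpa [PCNF.univB, PhiF] using hv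
  ex := by intro z hz; simp [PCNF.existB, PhiF, hz]
  lv := by
    intro z hz y hy
    have h1 : z ∉ Xlist n := fun h => XZ_disj h hz
    have h2 : z ∉ Ylist n := fun h => YZ_disj h hz
    have h3 : y ∉ Xlist n := fun h => XY_disj h hy
    simp [PCNF.lv, PhiF, List.findIdx_cons, h1, h2, h3, hz, hy]

theorem pre_omega (n : ℕ) : Pre n (OmegaF n) where
  mat := rfl
  univ := by intro v hv; simpa [PCNF.univB, OmegaF] using hv
  ex := by intro z hz; simp [PCNF.existB, OmegaF, hz]
  lv := by
    intro z hz y hy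
    have h2 : z ∉ Ylist n := fun h => YZ_disj h hz
    simp [PCNF.lv, OmegaF, List.findIdx_cons, h2, hz, hy]

theorem valid_induct {Φ : PCNF} {b : Bool} {π : List Clause} (h : QValid Φ b π)
    (P : Clause → Prop)
    (step : ∀ prev : List Clause, (∀ A ∈ prev, P A) → ∀ C ∈ π, QStep Φ b prev C → P C) :
    ∀ C ∈ π, P C := by
  have key : ∀ i, i < π.length → P π[i]! := by
    intro i
    induction i using Nat.strong_induction_on with
    | _ i ih =>
      intro hi
      refine step (π.take i) ?_ _ ?_ (h i hi)
      · intro A hA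
        rw [List.mem_take_iff_getElem] at hA
        obtain ⟨j, hj, rfl⟩ := hA
        have := ih j (by omega) (by omega)
        rwa [getElem!_pos π j (by omega)] at this
      · rw [getElem!_pos π i hi]; exact List.getElem_mem _
  intro C hC
  obtain ⟨i, hi, rfl⟩ := List.getElem_of_mem hC
  have := key i hi
  rwa [getElem!_pos π i hi] at this

theorem eval_res {v : ℕ → Bool} {A B : Clause} {x : ℕ} (hA : evalClause v A)
    (hB : evalClause v B) : evalClause v ((A.erase (Lit.pos x)) ∪ (B.erase (Lit.neg x))) := by
  obtain ⟨a, ha, hav⟩ := hA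
  obtain ⟨b, hb, hbv⟩ := hB
  by_cases h1 : a = Lit.pos x
  · by_cases h2 : b = Lit.neg x
    · subst h1; subst h2
      simp [Lit.eval] at hav hbv
      simp [hav] at hbv
    · exact ⟨b, by simp [h2, hb], hbv⟩
  · exact ⟨a, by simp [h1, ha], hav⟩

theorem yz_no_red {n : ℕ} {A : Clause} (hA : YZC n A) (hall : ∀ l ∈ A, l.var ∈ Ylist n) :
    False := by
  classical
  obtain ⟨_, hnt, himp⟩ := hA
  obtain ⟨v, hv, hsat⟩ := tphp_sat n (fun x => decide (Lit.neg x ∈ A))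
  obtain ⟨l, hl, hlv⟩ := himp v hsat
  have hy := hv _ (hall l hl)
  cases l with
  | pos x =>
    simp only [Lit.eval, Lit.var] at hlv hy
    rw [hy] at hlv
    exact hnt ⟨x, hl, of_decide_eq_true hlv⟩
  | neg x =>
    simp only [Lit.eval, Lit.var] at hlv hy
    rw [hy] at hlv
    simp [hl] at hlv

theorem dichotomy {n : ℕ} {Φ : PCNF} (hΦ : Pre n Φ) {π : List Clause}
    (hπ : QRefutation Φ false π) (Q : Clause → Prop)
    (hax : ∀ C ∈ PHPcls n, Q C)
    (hres : ∀ A B x, XC n A → XC n B → Q A → Q B →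
      XC n ((A.erase (Lit.pos x)) ∪ (B.erase (Lit.neg x))) →
      ((A.erase (Lit.pos x)) ∪ (B.erase (Lit.neg x))) ∈ π →
      Q ((A.erase (Lit.pos x)) ∪ (B.erase (Lit.neg x)))) : Q ∅ := by
  obtain ⟨hval, hne, hlast⟩ := hπ
  have hmem : (∅ : Clause) ∈ π := by
    rw [← hlast, List.getLast!_of_getLast? (List.getLast?_eq_getLast_of_ne_nil hne)]
    exact List.getLast_mem hne
  have key := valid_induct hval (fun C => (XC n C ∧ Q C) ∨ YZC n C) ?_ ∅ hmem
  · rcases key with h | h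
    · exact h.2
    · exact (yz_no_red h (by simp)).elim
  intro prev hprev C hCπ hstep
  cases hstep with
  | ax _ hC hnt =>
    rw [hΦ.mat, phiMatrix, Finset.mem_union] at hC
    rcases hC with hC | hC
    · exact Or.inr ⟨tphp_vars hC, hnt, fun v hv => hv C hC⟩
    · exact Or.inl ⟨php_vars hC, hax C hC⟩
  | res x A B hA hB hxa hxb hpiv hblock =>
    rcases hprev A hA with ⟨hXA, hQA⟩ | hYA <;> rcases hprev B hB with ⟨hXB, hQB⟩ | hYB
    · have hX : XC n ((A.erase (Lit.pos x)) ∪ (B.erase (Lit.neg x))) := by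
        intro l hl
        rcases Finset.mem_union.1 hl with h | h
        · exact hXA l (Finset.mem_of_mem_erase h)
        · exact hXB l (Finset.mem_of_mem_erase h)
      exact Or.inl ⟨hX, hres A B x hXA hXB hQA hQB hX hCπ⟩
    · have h1 := hXA _ hxa
      rcases hYB.1 _ hxb with h | h
      · exact (XY_disj h1 h).elim
      · exact (XZ_disj h1 h).elim
    · have h1 := hXB _ hxb
      rcases hYA.1 _ hxa with h | h
      · exact (XY_disj h1 h).elim
      · exact (XZ_disj h1 h).elim
    · refine Or.inr ⟨?_, ?_, fun v hv => eval_res (hYA.2.2 v hv) (hYB.2.2 v hv)⟩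
      · intro l hl
        rcases Finset.mem_union.1 hl with h | h
        · exact hYA.1 l (Finset.mem_of_mem_erase h)
        · exact hYB.1 l (Finset.mem_of_mem_erase h)
      · rintro ⟨y, hp, hn⟩
        rcases Finset.mem_union.1 hp with hp | hp <;> rcases Finset.mem_union.1 hn with hn | hn
        · exact hYA.2.1 ⟨y, Finset.mem_of_mem_erase hp, Finset.mem_of_mem_erase hn⟩
        · exact hblock _ hp hn
        · exact hblock _ hn hp
        · exact hYB.2.1 ⟨y, Finset.mem_of_mem_erase hp, Finset.mem_of_mem_erase hn⟩
  | fac _ hA => exact hprev C hA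
  | univRed A m hA hm hu hlv =>
    have hmY := hΦ.univ _ hu
    rcases hprev A hA with ⟨hXA, _⟩ | hYA
    · exact (XY_disj (hXA m hm) hmY).elim
    · refine (yz_no_red hYA ?_).elim
      intro l hl
      rcases hYA.1 l hl with h | h
      · exact h
      · by_cases hlm : l = m
        · rw [hlm]; exact hmY
        · exact (hΦ.lv _ h _ hmY
            (hlv l (Finset.mem_erase.2 ⟨hlm, hl⟩) (hΦ.ex _ h))).elim

/-! ### monotone translation -/

open Classical in
noncomputable def mono (n : ℕ) (C : Clause) : Finset (Edge n) :=
  Finset.univ.filter fun e => Lit.pos (xv (e.1+1) (e.2+1)) ∈ C ∨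
    ∃ i' : Fin (n+1), i' ≠ e.1 ∧ Lit.neg (xv (i'+1) (e.2+1)) ∈ C

open Classical in
noncomputable def asg {n : ℕ} (σ : Crit n) : ℕ → Bool := fun x =>
  decide (∃ (i : Fin (n+1)) (j : Fin n), x = xv (i+1) (j+1) ∧ σ i = some j)

theorem asg_xv {n : ℕ} (σ : Crit n) (i : Fin (n+1)) (j : Fin n) :
    asg σ (xv (i+1) (j+1)) = true ↔ σ i = some j := by
  classical
  simp only [asg, decide_eq_true_eq]
  constructor
  · rintro ⟨i', j', h, hs⟩
    simp only [xv, Nat.pair_eq_pair, Nat.add_right_cancel_iff, true_and, and_true] at h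
    have h1 : i = i' := Fin.ext h.1
    have h2 : j = j' := Fin.ext h.2
    rw [h1, h2]; exact hs
  · intro h; exact ⟨i, j, rfl, h⟩

theorem hits_iff {n : ℕ} {C : Clause} (hC : XC n C) (σ : Crit n) :
    Hits (mono n C) σ ↔ evalClause (asg σ) C := by
  classical
  constructor
  · rintro ⟨e, he, hs⟩
    simp only [mono, Finset.mem_filter, Finset.mem_univ, true_and] at he
    rcases he with he | ⟨i', hne, he⟩
    · exact ⟨_, he, (asg_xv σ _ _).2 hs⟩
    · refine ⟨_, he, ?_⟩
      simp only [Lit.eval, Bool.not_eq_true', Bool.eq_false_iff, ne_eq, asg_xv]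
      intro h
      exact hne (σ.injective (h.trans hs.symm))
  · rintro ⟨l, hl, hv⟩
    obtain ⟨i, hi, j, hj, hx⟩ := mem_Xlist.1 (hC l hl)
    have ha := asg_xv σ ⟨i, hi⟩ ⟨j, hj⟩
    cases l with
    | pos x =>
      simp only [Lit.var] at hx
      subst hx
      refine ⟨(⟨i, hi⟩, ⟨j, hj⟩), ?_, ha.1 hv⟩
      simp only [mono, Finset.mem_filter, Finset.mem_univ, true_and]
      exact Or.inl hl
    | neg x =>
      simp only [Lit.var] at hx
      subst hx
      refine ⟨(σ.symm (some ⟨j, hj⟩), ⟨j, hj⟩), ?_, by simp⟩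
      simp only [mono, Finset.mem_filter, Finset.mem_univ, true_and]
      refine Or.inr ⟨⟨i, hi⟩, ?_, hl⟩
      intro h
      simp only [Lit.eval, Bool.not_eq_true', Bool.eq_false_iff, ne_eq] at hv
      apply hv
      exact ha.2 (by rw [h]; simp)

theorem php_eval {n : ℕ} {C : Clause} (hC : C ∈ PHPcls n) :
    ∃ i0 : Fin (n+1), ∀ σ : Crit n, ¬ evalClause (asg σ) C → σ i0 = none := by
  simp only [PHPcls, Finset.mem_union, List.mem_toFinset,
    List.mem_flatMap, List.mem_filterMap, List.mem_map, List.mem_range] at hC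
  rcases hC with ⟨i, hi, rfl⟩ | ⟨j, hj, i₁, h1, i₂, h2, hC⟩
  · refine ⟨⟨i, hi⟩, fun σ h => ?_⟩
    by_contra hne
    obtain ⟨j, hj⟩ := Option.ne_none_iff_exists'.1 hne
    exact h ⟨Lit.pos (xv (i+1) (j+1)), by
      simp only [List.mem_toFinset, List.mem_map, List.mem_range]
      exact ⟨j, j.2, rfl⟩,
      (asg_xv σ ⟨i, hi⟩ j).2 hj⟩
  · split_ifs at hC with h12
    simp only [Option.some.injEq] at hC
    subst hC
    refine ⟨0, fun σ h => (h ?_).elim⟩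
    by_cases ha : σ ⟨i₁, h1⟩ = some ⟨j, hj⟩
    · refine ⟨Lit.neg (xv (i₂+1) (j+1)), by simp, ?_⟩
      simp only [Lit.eval, Bool.not_eq_true', Bool.eq_false_iff, ne_eq]
      intro hb
      have := (asg_xv σ ⟨i₂, h2⟩ ⟨j, hj⟩).1 hb
      have := σ.injective (ha.trans this.symm)
      simp at this
      omega
    · refine ⟨Lit.neg (xv (i₁+1) (j+1)), by simp, ?_⟩
      simp only [Lit.eval, Bool.not_eq_true', Bool.eq_false_iff, ne_eq]
      intro hb
      exact ha ((asg_xv σ ⟨i₁, h1⟩ ⟨j, hj⟩).1 hb)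

theorem card_le_qSize (π : List Clause) :
    (π.toFinset.filter fun C => C ≠ ∅).card ≤ qSize π := by
  induction π with
  | nil => simp [qSize]
  | cons C π ih =>
    rw [List.toFinset_cons, Finset.filter_insert]
    have hs : qSize (C :: π) = C.card + qSize π := by simp [qSize]
    split_ifs with h
    · have h1 : 0 < C.card := Finset.card_pos.2 (Finset.nonempty_iff_ne_empty.2 h)
      have := Finset.card_insert_le C (π.toFinset.filter fun C => C ≠ ∅)
      omega
    · omega

theorem lower {n : ℕ} (hn : 10 ≤ n) {Φ : PCNF} (hΦ : Pre n Φ) {π : List Clause}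
    (hπ : QRefutation Φ false π) : 20 ^ (n/2) ≤ qSize π * 19 ^ (n/2) := by
  classical
  by_contra hlt
  push Not at hlt
  obtain ⟨σ0, R, hRk, hR, hF⟩ := greedy (n := n) (by omega)
    (π.toFinset.filter fun C => C ≠ ∅) (mono n) (n/2)
  have hzero := hF.trans_lt ((Nat.mul_le_mul_right _ (card_le_qSize π)).trans_lt hlt)
  have hz : ((π.toFinset.filter fun C => C ≠ ∅).filter fun c =>
      Unhit σ0 R (mono n c) ∧ Big σ0 R (mono n c)).card = 0 := by
    by_contra h
    have := Nat.le_mul_of_pos_left (20 ^ (n/2)) (Nat.pos_of_ne_zero h)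
    omega
  rw [Finset.card_eq_zero] at hz
  set m := n + 1 - R.card with hm
  have hm2 : n + 1 ≤ 2 * m := by omega
  have hmid : ∀ C ∈ π, m ≤ 3 * (miss σ0 R (mono n C)).card →
      3 * (miss σ0 R (mono n C)).card ≤ 2 * m → False := by
    intro C hC h1 h2
    have hsw := swap_count σ0 R hR (mono n C)
    rw [← hm] at hsw
    set μ := (miss σ0 R (mono n C)).card with hμ
    obtain ⟨d, hd⟩ : ∃ d, m = μ + d := ⟨m - μ, by omega⟩
    have hd' : m - μ = d := by omega
    rw [hd'] at hsw
    have hbig : n * (n+1) ≤ 20 * (μ * d) := by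
      have h3 : μ ≤ 2 * d := by omega
      have h4 : d ≤ 2 * μ := by omega
      have h5 : n + 1 ≤ 2 * (μ + d) := by omega
      have h6 : (n+1) * (n+1) ≤ (2 * (μ+d)) * (2 * (μ + d)) := Nat.mul_le_mul h5 h5
      zify at h3 h4 h6 ⊢
      nlinarith [mul_nonneg (sub_nonneg.2 h3) (sub_nonneg.2 h4)]
    have hB : Big σ0 R (mono n C) := by
      unfold Big; omega
    have hμpos : 0 < μ := by omega
    obtain ⟨i, hi⟩ := Finset.card_pos.1 hμpos
    have hU := miss_unhit σ0 R _ hi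
    have hCne : C ≠ ∅ := by
      rintro rfl
      have : mono n (∅ : Clause) = ∅ := by simp [mono]
      unfold Big at hB
      rw [this] at hB
      simp at hB
      omega
    have : C ∈ ((π.toFinset.filter fun C => C ≠ ∅).filter fun c =>
      Unhit σ0 R (mono n c) ∧ Big σ0 R (mono n c)) := by
      simp [hC, hCne, hU, hB]
    rw [hz] at this
    simp at this
  have hQ := dichotomy hΦ hπ (fun C => 3 * (miss σ0 R (mono n C)).card < m) ?_ ?_
  · have : miss σ0 R (mono n (∅ : Clause)) = Rᶜ := by
      ext i
      constructor
      · intro hi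
        simpa using miss_sub σ0 R hR _ hi
      · intro hi
        rw [Finset.mem_compl] at hi
        simp only [miss, Finset.mem_filter, Finset.mem_univ, true_and]
        refine ⟨(Equiv.swap i (σ0.symm none)).trans σ0, ?_, ?_, ?_⟩
        · intro p hp
          have h1 : p ≠ i := fun h => hi (h ▸ hp)
          have h2 : p ≠ σ0.symm none := fun h => hR p hp (by rw [h]; simp)
          simp [Equiv.swap_apply_of_ne_of_ne h1 h2]
        · simp
        · simp [Hits, mono]
    simp only [this, Finset.card_compl, Fintype.card_fin] at hQ
    omega
  · intro C hC
    obtain ⟨i0, hi0⟩ := php_eval hC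
    have : miss σ0 R (mono n C) ⊆ {i0} := by
      intro i hi
      simp only [miss, Finset.mem_filter, Finset.mem_univ, true_and] at hi
      obtain ⟨σ, _, h2, h3⟩ := hi
      rw [hits_iff (php_vars hC)] at h3
      rw [Finset.mem_singleton]
      exact σ.injective (h2.trans (hi0 σ h3).symm)
    have := Finset.card_le_card this
    simp only [Finset.card_singleton] at this
    omega
  · intro A B x hXA hXB hA hB hX hmem
    have hsub : miss σ0 R (mono n ((A.erase (Lit.pos x)) ∪ (B.erase (Lit.neg x)))) ⊆
        miss σ0 R (mono n A) ∪ miss σ0 R (mono n B) := by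
      intro i hi
      simp only [miss, Finset.mem_filter, Finset.mem_univ, true_and, Finset.mem_union] at hi ⊢
      obtain ⟨σ, h1, h2, h3⟩ := hi
      rw [hits_iff hX] at h3
      by_cases ha : Hits (mono n A) σ
      · refine Or.inr ⟨σ, h1, h2, fun hb => h3 ?_⟩
        exact eval_res ((hits_iff hXA σ).1 ha) ((hits_iff hXB σ).1 hb)
      · exact Or.inl ⟨σ, h1, h2, ha⟩
    have h1 := (Finset.card_le_card hsub).trans (Finset.card_union_le _ _)
    by_contra hcon
    exact hmid _ hmem (by omega) (by omega)

theorem pow_half_le (n : ℕ) : ((19:ℝ)/20) ^ (n/2) ≤ (100/98) * (98/100) ^ n := by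
  have h1 : ((19:ℝ)/20) ^ (n/2) ≤ (98/100) ^ (2 * (n/2)) := by
    rw [pow_mul]
    exact pow_le_pow_left₀ (by norm_num) (by norm_num) _
  have h2 : ((98:ℝ)/100) ^ (2 * (n/2)) * (98/100) ≤ (98/100) ^ n := by
    rw [← pow_succ]
    rcases Nat.even_or_odd' n with ⟨c, rfl | rfl⟩
    · have : 2 * (2 * c / 2) = 2 * c := by omega
      rw [this]
      exact pow_le_pow_of_le_one (by norm_num) (by norm_num) (by omega)
    · have : 2 * ((2 * c + 1) / 2) = 2 * c := by omega
      rw [this]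
  linarith

theorem poly_tendsto (q : Polynomial ℕ) : Filter.Tendsto
    (fun n : ℕ => ((q.eval n : ℕ) : ℝ) * (19/20) ^ (n/2)) Filter.atTop (nhds 0) := by
  induction q using Polynomial.induction_on' with
  | add p q hp hq =>
    have := hp.add hq
    rw [add_zero] at this
    refine this.congr fun n => ?_
    rw [Polynomial.eval_add]; push_cast; ring
  | monomial k a =>
    have h := (tendsto_pow_const_mul_const_pow_of_abs_lt_one k (r := (98:ℝ)/100)
      (by rw [abs_of_pos] <;> norm_num)).const_mul ((a:ℝ) * (100/98))
    rw [mul_zero] at h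
    refine squeeze_zero (fun n => by positivity) (fun n => ?_) h
    rw [Polynomial.eval_monomial]
    push_cast
    have := mul_le_mul_of_nonneg_left (pow_half_le n) (by positivity : (0:ℝ) ≤ a * (n:ℝ) ^ k)
    linarith

theorem poly_small (q : Polynomial ℕ) :
    ∃ N : ℕ, ∀ n, N ≤ n → q.eval n * 19 ^ (n/2) < 20 ^ (n/2) := by
  have h := (poly_tendsto q).eventually_lt_const (show (0:ℝ) < 1 by norm_num)
  obtain ⟨N, hN⟩ := Filter.eventually_atTop.1 h
  refine ⟨N, fun n hn => ?_⟩
  have h1 := hN n hn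
  rw [div_pow, ← mul_div_assoc, div_lt_one (by positivity)] at h1
  exact_mod_cast h1

end Haken
/-- every Q-res refutation of Φ_n and of Ω_n has
superpolynomial size. -/
theorem qres_superpolynomial_on_Phi_Omega :
    ∀ q : Polynomial ℕ, ∃ N : ℕ, ∀ n : ℕ, N ≤ n →
      (∀ π : List Clause, QRefutation (PhiF n) false π → q.eval n < qSize π) ∧
      (∀ π : List Clause, QRefutation (OmegaF n) false π → q.eval n < qSize π) := by
  intro q
  obtain ⟨N, hN⟩ := Haken.poly_small q
  refine ⟨max N 10, fun n hn => ?_⟩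
  have h10 : 10 ≤ n := le_trans (le_max_right _ _) hn
  have hq := hN n (le_trans (le_max_left _ _) hn)
  exact ⟨fun π hπ => lt_of_mul_lt_mul_right
      (hq.trans_le (Haken.lower h10 (Haken.pre_phi n) hπ)) (Nat.zero_le _),
    fun π hπ => lt_of_mul_lt_mul_right
      (hq.trans_le (Haken.lower h10 (Haken.pre_omega n) hπ)) (Nat.zero_le _)⟩
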